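/- Fix ν ∈ (0,1), λ > 0, Δx > 0 and y_0 ∈ ℝ, and let (y_j)_{j≥0} solve the eigenvalue scheme. Then with ȳ_0 = y_0 and ȳ_j = y_j − θ·y_{j−1} for j ≥ 1, where θ = 2ν/(2+ν), one has ȳ_j² + α̃·y_j² ≤ y_0² for every integer j ≥ 1. -/

import Mathlib

open Real Finset

noncomputable section

/-- α₀ = (ν+2)/(2^ν·Γ(3−ν)). -/
def alpha0 (ν : ℝ) : ℝ := (ν + 2) / ((2 : ℝ) ^ ν * Real.Gamma (3 - ν))

/-- θ = 2ν/(2+ν). -/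
def theta (ν : ℝ) : ℝ := 2 * ν / (2 + ν)

/-- The coefficients D̄_k^(m). -/
def Dbar (ν : ℝ) (m k : ℕ) : ℝ :=
  if k = 0 then
    (1 / Real.Gamma (3 - ν)) *
      (-((2 - ν) / 2) * ((2 * m : ℝ) ^ (1 - ν) + 3 * ((2 * m : ℝ) + 2) ^ (1 - ν))
        - (2 * m : ℝ) ^ (2 - ν) + ((2 * m : ℝ) + 2) ^ (2 - ν))
  else if k % 2 = 0 then
    (1 / Real.Gamma (3 - ν)) *
      (-((2 - ν) / 2) * (((2 * m : ℝ) - 2 * (k / 2 : ℕ)) ^ (1 - ν)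
          + 6 * ((2 * m : ℝ) - 2 * (k / 2 : ℕ) + 2) ^ (1 - ν)
          + ((2 * m : ℝ) - 2 * (k / 2 : ℕ) + 4) ^ (1 - ν))
        - ((2 * m : ℝ) - 2 * (k / 2 : ℕ)) ^ (2 - ν)
        + ((2 * m : ℝ) - 2 * (k / 2 : ℕ) + 4) ^ (2 - ν))
  else
    (2 / Real.Gamma (3 - ν)) *
      ((2 - ν) * (((2 * m : ℝ) - 2 * (k / 2 : ℕ)) ^ (1 - ν)
          + ((2 * m : ℝ) - 2 * (k / 2 : ℕ) + 2) ^ (1 - ν))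
        + ((2 * m : ℝ) - 2 * (k / 2 : ℕ)) ^ (2 - ν)
        - ((2 * m : ℝ) - 2 * (k / 2 : ℕ) + 2) ^ (2 - ν))

/-- The coefficients D_k^(m); for k ≥ 3 one has D_k^(m) = D̄_{k+1}^(m). -/
def Dco (ν : ℝ) (m k : ℕ) : ℝ :=
  if k = 0 then
    (1 / Real.Gamma (3 - ν)) *
      (((2 - ν) / 2) * ((2 * m : ℝ) ^ (1 - ν) - 3 * ((2 * m : ℝ) + 1) ^ (1 - ν))
        - (2 * m : ℝ) ^ (2 - ν) + ((2 * m : ℝ) + 1) ^ (2 - ν))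
  else if k = 1 then
    (1 / Real.Gamma (3 - ν)) *
      (-((2 - ν) / 2) * (((2 * m : ℝ) - 2) ^ (1 - ν) + 3 * (2 * m : ℝ) ^ (1 - ν)
          - 4 * ((2 * m : ℝ) + 1) ^ (1 - ν))
        - ((2 * m : ℝ) - 2) ^ (2 - ν) + 3 * (2 * m : ℝ) ^ (2 - ν)
        - 2 * ((2 * m : ℝ) + 1) ^ (2 - ν))
  else if k = 2 then
    (1 / Real.Gamma (3 - ν)) *
      (((2 - ν) / 2) * (4 * ((2 * m : ℝ) - 2) ^ (1 - ν) + 3 * (2 * m : ℝ) ^ (1 - ν)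
          - ((2 * m : ℝ) + 1) ^ (1 - ν))
        + 2 * ((2 * m : ℝ) - 2) ^ (2 - ν) - 3 * (2 * m : ℝ) ^ (2 - ν)
        + ((2 * m : ℝ) + 1) ^ (2 - ν))
  else Dbar ν m (k + 1)

/-- The scheme coefficients d_k^j. -/
def dco (ν : ℝ) (j k : ℕ) : ℝ :=
  if j % 2 = 1 then -Dco ν (j / 2) k / alpha0 ν
  else -Dbar ν (j / 2 - 1) k / alpha0 ν

/-- The transformed coefficients d̄_k^j. -/
def dbarco (ν : ℝ) (j k : ℕ) : ℝ :=
  if k = j then -1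
  else if j = 3 then
    if k = 2 then dco ν 3 2 - theta ν
    else if k = 1 then theta ν * (dco ν 3 2 - theta ν) + dco ν 3 1
    else theta ν * (theta ν * (dco ν 3 2 - theta ν) + dco ν 3 1) + dco ν 3 0
  else
    theta ν ^ (j - k) + ∑ k' ∈ Finset.Icc k (j - 2), dco ν j k' * theta ν ^ (k' - k)

/-- The coefficients B̄_i^n: B̄_0^n = Δx^{−ν}α₀ and
    B̄_{n−k}^n = B̄_{n−k−1}^n − Δx^{−ν}·α₀·d̄_k^n for k = n−1,…,1. -/
def Bbar (ν Δx : ℝ) (n : ℕ) : ℕ → ℝ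
  | 0 => Δx ^ (-ν) * alpha0 ν
  | i + 1 => Bbar ν Δx n i - Δx ^ (-ν) * alpha0 ν * dbarco ν n (n - (i + 1))

/-- The complementary discrete kernels P_j^n. -/
def Pker (ν Δx : ℝ) (n : ℕ) : ℕ → ℝ
  | 0 => 1 / Bbar ν Δx n 0
  | j + 1 =>
    if n ≤ j + 3 then 0
    else (1 / Bbar ν Δx (n - (j + 1)) 0) *
      ∑ k ∈ (Finset.range (j + 1)).attach,
        (Bbar ν Δx (n - k.1) (j - k.1) - Bbar ν Δx (n - k.1) (j + 1 - k.1)) * Pker ν Δx n k.1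
  decreasing_by
    have := Finset.mem_range.mp k.2; omega

/-- D̂_0, D̂_1, D̂_2, D̃_0, D̃_1, D̃_2 : first/second-step coefficients. -/
def Dhat0 (ν : ℝ) : ℝ := (3 * ν - 4) / (2 * Real.Gamma (3 - ν))
def Dhat1 (ν : ℝ) : ℝ := 2 * (1 - ν) / Real.Gamma (3 - ν)
def Dhat2 (ν : ℝ) : ℝ := ν / (2 * Real.Gamma (3 - ν))
def Dtil0 (ν : ℝ) : ℝ := (3 * ν - 2) / ((2 : ℝ) ^ ν * Real.Gamma (3 - ν))
def Dtil1 (ν : ℝ) : ℝ := -(4 * ν) / ((2 : ℝ) ^ ν * Real.Gamma (3 - ν))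
def Dtil2 (ν : ℝ) : ℝ := (ν + 2) / ((2 : ℝ) ^ ν * Real.Gamma (3 - ν))

/-- The Caputo fractional derivative of order ν. -/
def caputo (ν : ℝ) (y : ℝ → ℝ) (x : ℝ) : ℝ :=
  (1 / Real.Gamma (1 - ν)) * ∫ s in (0:ℝ)..x, (x - s) ^ (-ν) * deriv y s

/-- The discrete Caputo derivative of a function y at the grid point x_j = jΔx. -/
def discCaputo (ν Δx : ℝ) (y : ℝ → ℝ) (j : ℕ) : ℝ :=
  if j = 1 then
    Δx ^ (-ν) * (Dhat0 ν * y 0 + Dhat1 ν * y Δx + Dhat2 ν * y (2 * Δx))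
  else if j = 2 then
    Δx ^ (-ν) * (Dtil0 ν * y 0 + Dtil1 ν * y Δx + Dtil2 ν * y (2 * Δx))
  else if j % 2 = 1 then
    Δx ^ (-ν) * ((∑ k ∈ Finset.range j, Dco ν (j / 2) k * y ((k : ℝ) * Δx))
      + alpha0 ν * y ((j : ℝ) * Δx))
  else
    Δx ^ (-ν) * ((∑ k ∈ Finset.range j, Dbar ν (j / 2 - 1) k * y ((k : ℝ) * Δx))
      + alpha0 ν * y ((j : ℝ) * Δx))

/-- Truncation error r_j(Δx). -/
def trunc (ν Δx : ℝ) (y : ℝ → ℝ) (j : ℕ) : ℝ :=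
  caputo ν y ((j : ℝ) * Δx) - discCaputo ν Δx y j

/-- The Mittag–Leffler function E_ν(z) = Σ_{k≥0} z^k/Γ(1+kν). -/
def mlE (ν z : ℝ) : ℝ := ∑' k : ℕ, z ^ k / Real.Gamma (1 + (k : ℝ) * ν)

end

/-- Peano-kernel comparison: integrating a quadratic kernel `K` against the second derivative of
`t ↦ t ^ p` by parts, with `M` a surrogate for `t ^ (p - 2)` that is smaller where `K` is positive
and larger where `K` is negative. -/
lemma rpow_quadratic_kernel_le {p a b c k0 k1 k2 M : ℝ} (hp0 : 0 < p) (hp1 : p < 1) (ha : 0 < a)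
    (hab : a ≤ b)
    (hK : ∀ t, a ≤ t → t ≤ b →
      0 ≤ (k0 + k1 * (t - c) + k2 * (t - c) ^ 2) * (t ^ (p - 2) - M)) :
    (p + 1) * ((k0 + k1 * (b - c) + k2 * (b - c) ^ 2) * (p * b ^ (p - 1))
        - (k1 + 2 * k2 * (b - c)) * b ^ p) + 2 * k2 * (b * b ^ p)
      + (p + 1) * p * (1 - p) * M
        * (k0 * (b - c) + k1 * (b - c) ^ 2 / 2 + k2 * (b - c) ^ 3 / 3)
    ≤ (p + 1) * ((k0 + k1 * (a - c) + k2 * (a - c) ^ 2) * (p * a ^ (p - 1))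
        - (k1 + 2 * k2 * (a - c)) * a ^ p) + 2 * k2 * (a * a ^ p)
      + (p + 1) * p * (1 - p) * M
        * (k0 * (a - c) + k1 * (a - c) ^ 2 / 2 + k2 * (a - c) ^ 3 / 3) := by
  set G : ℝ → ℝ := fun t =>
    (p + 1) * ((k0 + k1 * (t - c) + k2 * (t - c) ^ 2) * (p * t ^ (p - 1))
        - (k1 + 2 * k2 * (t - c)) * t ^ p) + 2 * k2 * (t * t ^ p)
      + (p + 1) * p * (1 - p) * M
        * (k0 * (t - c) + k1 * (t - c) ^ 2 / 2 + k2 * (t - c) ^ 3 / 3) with hG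
  have hderiv : ∀ t, 0 < t → HasDerivAt G
      (-((p + 1) * p * (1 - p)
        * ((k0 + k1 * (t - c) + k2 * (t - c) ^ 2) * (t ^ (p - 2) - M)))) t := by
    intro t ht
    have e0 : HasDerivAt (fun t : ℝ => t - c) 1 t := (hasDerivAt_id t).sub_const c
    have e1 : HasDerivAt (fun t : ℝ => t ^ p) (p * t ^ (p - 1)) t :=
      Real.hasDerivAt_rpow_const (Or.inl ht.ne')
    have e2 : HasDerivAt (fun t : ℝ => t ^ (p - 1)) ((p - 1) * t ^ (p - 1 - 1)) t :=
      Real.hasDerivAt_rpow_const (Or.inl ht.ne')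
    have e3 : t ^ p = t * t ^ (p - 1) := by
      rw [Real.rpow_sub_one ht.ne']; field_simp
    have e4 : p - 1 - 1 = p - 2 := by ring
    have key := (((((e0.const_mul k1).const_add k0).add ((e0.pow 2).const_mul k2)).mul
      (e2.const_mul p)).sub (((e0.const_mul (2 * k2)).const_add k1).mul e1)).const_mul (p + 1)
      |>.add (((hasDerivAt_id t).mul e1).const_mul (2 * k2))
      |>.add ((((e0.const_mul k0).add (((e0.pow 2).const_mul k1).div_const 2)).add
        (((e0.pow 3).const_mul k2).div_const 3)).const_mul ((p + 1) * p * (1 - p) * M))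
    refine key.congr_deriv ?_
    simp only [Pi.add_apply, Pi.pow_apply, id, e4, e3]
    push_cast
    ring
  have hanti : AntitoneOn G (Set.Icc a b) := by
    refine antitoneOn_of_deriv_nonpos (convex_Icc a b)
      (fun t ht => (hderiv t (ha.trans_le ht.1)).continuousAt.continuousWithinAt)
      (fun t ht => ?_) (fun t ht => ?_)
    · rw [interior_Icc] at ht
      exact (hderiv t (ha.trans ht.1)).differentiableAt.differentiableWithinAt
    · rw [interior_Icc] at ht
      rw [(hderiv t (ha.trans ht.1)).deriv, neg_nonpos]
      have := sub_pos.2 hp1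
      exact mul_nonneg (by positivity) (hK t ht.1.le ht.2.le)
  exact hanti (Set.left_mem_Icc.2 hab) (Set.right_mem_Icc.2 hab) hab

lemma rpow_le_two_rpow_mul {x c r : ℝ} (hc : 0 < c) (hx : c / 2 ≤ x) (hr : 0 ≤ r) :
    x ^ (-r) ≤ (2 : ℝ) ^ r * c ^ (-r) := by
  calc x ^ (-r) ≤ (c / 2) ^ (-r) :=
        Real.rpow_le_rpow_of_nonpos (by positivity) hx (by linarith)
    _ = (2 : ℝ) ^ r * c ^ (-r) := by
        rw [Real.div_rpow hc.le (by norm_num), Real.rpow_neg (by norm_num : (0:ℝ) ≤ 2)]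
        field_simp

lemma rpow_sub_two_le {x c p : ℝ} (hp : 0 < p) (hp2 : p < 1) (hc : 0 < c) (hx : c / 2 ≤ x) :
    x ^ (p - 2) ≤ 4 * c ^ (p - 2) := by
  have h := rpow_le_two_rpow_mul hc hx (r := 2 - p) (by linarith)
  have h2 : (2 : ℝ) ^ (2 - p) ≤ (2 : ℝ) ^ (2 : ℝ) :=
    Real.rpow_le_rpow_of_exponent_le (by norm_num) (by linarith)
  norm_num at h2
  rw [neg_sub] at h
  exact h.trans (mul_le_mul_of_nonneg_right h2 (by positivity))

lemma rpow_sub_one_le {x c p : ℝ} (hp : 0 < p) (hp2 : p < 1) (hc : 0 < c) (hx : c / 2 ≤ x) :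
    x ^ (p - 1) ≤ 2 * c ^ (p - 1) := by
  have h := rpow_le_two_rpow_mul hc hx (r := 1 - p) (by linarith)
  have h2 : (2 : ℝ) ^ (1 - p) ≤ (2 : ℝ) ^ (1 : ℝ) :=
    Real.rpow_le_rpow_of_exponent_le (by norm_num) (by linarith)
  rw [Real.rpow_one] at h2
  rw [neg_sub] at h
  exact h.trans (mul_le_mul_of_nonneg_right h2 (by positivity))

lemma rpow_sub_two_anti {x z p : ℝ} (hp : p < 1) (hx : 0 < x) (hxz : x ≤ z) :
    z ^ (p - 2) ≤ x ^ (p - 2) :=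
  Real.rpow_le_rpow_of_nonpos hx hxz (by linarith)

/-- The trapezoidal rule underestimates the integral of `t ^ p`. -/
lemma rpow_trapezoid {p a : ℝ} (hp0 : 0 < p) (hp1 : p < 1) (ha : 0 ≤ a) :
    (p + 1) * (a ^ p + (a + 2) ^ p) + a * a ^ p - (a + 2) * (a + 2) ^ p ≤ 0 := by
  rcases ha.eq_or_lt with rfl | ha
  · simp only [Real.zero_rpow hp0.ne', zero_add, mul_zero]
    have : 0 < (2 : ℝ) ^ p := by positivity
    nlinarith
  · have h := rpow_quadratic_kernel_le (c := a) (k0 := 0) (k1 := 1) (k2 := -1 / 2) (M := 0)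
      hp0 hp1 ha (by linarith : a ≤ a + 2) (fun t h1 h2 => by
        have : 0 ≤ t ^ (p - 2) := Real.rpow_nonneg (by linarith) _
        rw [sub_zero]
        refine mul_nonneg ?_ this
        nlinarith)
    ring_nf at h ⊢
    linarith

/-- Comparison for the even interior nodes. -/
lemma rpow_even_node {p c : ℝ} (hp0 : 0 < p) (hp1 : p < 1) (hc : 4 ≤ c) :
    -((p + 1) / 2) * ((c - 2) ^ p + 6 * c ^ p + (c + 2) ^ p)
      - (c - 2) * (c - 2) ^ p + (c + 2) * (c + 2) ^ p ≤ 0 := by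
  have hA := rpow_quadratic_kernel_le (c := c - 2) (k0 := 0) (k1 := -1 / 2) (k2 := 1 / 2)
    (M := (c - 2) ^ (p - 2)) hp0 hp1 (by linarith : 0 < c - 2) (by linarith : c - 2 ≤ c - 1)
    (fun t h1 h2 => by
      have := rpow_sub_two_anti hp1 (by linarith : 0 < c - 2) h1
      exact mul_nonneg_of_nonpos_of_nonpos (by nlinarith) (by linarith))
  have hB := rpow_quadratic_kernel_le (c := c - 2) (k0 := 0) (k1 := -1 / 2) (k2 := 1 / 2)
    (M := c ^ (p - 2)) hp0 hp1 (by linarith : 0 < c - 1) (by linarith : c - 1 ≤ c)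
    (fun t h1 h2 => by
      have := rpow_sub_two_anti hp1 (by linarith : 0 < t) h2
      exact mul_nonneg (by nlinarith) (by linarith))
  have hC := rpow_quadratic_kernel_le (c := c + 2) (k0 := 0) (k1 := 1 / 2) (k2 := 1 / 2)
    (M := (c + 1) ^ (p - 2)) hp0 hp1 (by linarith : 0 < c) (by linarith : c ≤ c + 2)
    (fun t h1 h2 => by
      rcases le_total t (c + 1) with h | h
      · have := rpow_sub_two_anti hp1 (by linarith : 0 < t) h
        exact mul_nonneg (by nlinarith) (by linarith)
      · have := rpow_sub_two_anti hp1 (by linarith : 0 < c + 1) h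
        exact mul_nonneg_of_nonpos_of_nonpos (by nlinarith) (by linarith))
  have hM := rpow_sub_two_le hp0 hp1 (by linarith : 0 < c) (by linarith : c / 2 ≤ c - 2)
  have hM0 : 0 ≤ c ^ (p - 2) := Real.rpow_nonneg (by linarith) _
  have hM1 : 0 ≤ (c + 1) ^ (p - 2) := Real.rpow_nonneg (by linarith) _
  have hq : 0 ≤ (p + 1) * p * (1 - p) := by have := sub_pos.2 hp1; positivity
  have hfin : 0 ≤ (p + 1) * p * (1 - p) *
      (-(c - 2) ^ (p - 2) / 12 + 5 / 12 * c ^ (p - 2) + (c + 1) ^ (p - 2) / 3) :=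
    mul_nonneg hq (by linarith)
  linear_combination hA + hB + hC + hfin

/-- Comparison for the first node of an odd row. -/
lemma rpow_odd_row_one {p a : ℝ} (hp0 : 0 < p) (hp1 : p < 1) (ha : 4 ≤ a) :
    -((p + 1) / 2) * ((a - 2) ^ p + 3 * a ^ p - 4 * (a + 1) ^ p)
      - (a - 2) * (a - 2) ^ p + 3 * (a * a ^ p) - 2 * ((a + 1) * (a + 1) ^ p) ≤ 0 := by
  have hA := rpow_quadratic_kernel_le (c := a - 2) (k0 := 0) (k1 := -1 / 2) (k2 := 1 / 2)
    (M := (a - 2) ^ (p - 2)) hp0 hp1 (by linarith : 0 < a - 2) (by linarith : a - 2 ≤ a - 1)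
    (fun t h1 h2 => by
      have := rpow_sub_two_anti hp1 (by linarith : 0 < a - 2) h1
      exact mul_nonneg_of_nonpos_of_nonpos (by nlinarith) (by linarith))
  have hB := rpow_quadratic_kernel_le (c := a - 2) (k0 := 0) (k1 := -1 / 2) (k2 := 1 / 2)
    (M := a ^ (p - 2)) hp0 hp1 (by linarith : 0 < a - 1) (by linarith : a - 1 ≤ a)
    (fun t h1 h2 => by
      have := rpow_sub_two_anti hp1 (by linarith : 0 < t) h2
      exact mul_nonneg (by nlinarith) (by linarith))
  have hC := rpow_quadratic_kernel_le (c := a + 1) (k0 := 0) (k1 := -2) (k2 := -1)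
    (M := 0) hp0 hp1 (by linarith : 0 < a) (by linarith : a ≤ a + 1)
    (fun t h1 h2 => by
      have : 0 ≤ t ^ (p - 2) := Real.rpow_nonneg (by linarith) _
      rw [sub_zero]
      exact mul_nonneg (by nlinarith) this)
  have hM := rpow_sub_two_le hp0 hp1 (by linarith : 0 < a) (by linarith : a / 2 ≤ a - 2)
  have hM0 : 0 ≤ a ^ (p - 2) := Real.rpow_nonneg (by linarith) _
  have hq : 0 ≤ (p + 1) * p * (1 - p) := by have := sub_pos.2 hp1; positivity
  have hfin : 0 ≤ (p + 1) * p * (1 - p) *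
      (-(a - 2) ^ (p - 2) / 12 + 5 / 12 * a ^ (p - 2)) :=
    mul_nonneg hq (by linarith)
  linear_combination hA + hB + hC + hfin

/-- Comparison for the second node of an odd row. -/
lemma rpow_odd_row_two {p a : ℝ} (hp0 : 0 < p) (hp1 : p < 1) (ha : 2 < a) :
    ((p + 1) / 2) * (4 * (a - 2) ^ p + 3 * a ^ p - (a + 1) ^ p)
      + 2 * ((a - 2) * (a - 2) ^ p) - 3 * (a * a ^ p) + (a + 1) * (a + 1) ^ p ≤ 0 := by
  have hA := rpow_quadratic_kernel_le (c := a - 2) (k0 := 0) (k1 := 2) (k2 := -1)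
    (M := a ^ (p - 2)) hp0 hp1 (by linarith : 0 < a - 2) (by linarith : a - 2 ≤ a)
    (fun t h1 h2 => by
      have := rpow_sub_two_anti hp1 (by linarith : 0 < t) h2
      exact mul_nonneg (by nlinarith) (by linarith))
  have hB := rpow_quadratic_kernel_le (c := a + 1) (k0 := 0) (k1 := 1 / 2) (k2 := 1 / 2)
    (M := a ^ (p - 2)) hp0 hp1 (by linarith : 0 < a) (by linarith : a ≤ a + 1)
    (fun t h1 h2 => by
      have := rpow_sub_two_anti hp1 (by linarith : 0 < a) h1
      exact mul_nonneg_of_nonpos_of_nonpos (by nlinarith) (by linarith))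
  have hM0 : 0 ≤ a ^ (p - 2) := Real.rpow_nonneg (by linarith) _
  have hq : 0 ≤ (p + 1) * p * (1 - p) := by have := sub_pos.2 hp1; positivity
  have hfin : 0 ≤ (p + 1) * p * (1 - p) * (5 / 4 * a ^ (p - 2)) :=
    mul_nonneg hq (by linarith)
  linear_combination hA + hB + hfin

/-- Comparison for the initial node of an even row. -/
lemma rpow_even_row_zero {p a : ℝ} (hp0 : 0 < p) (hp1 : p < 1) (ha : 2 ≤ a) :
    -((p + 1) / 2) * (a ^ p + 3 * (a + 2) ^ p) - a * a ^ p + (a + 2) * (a + 2) ^ p ≤ 0 := by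
  have hA := rpow_quadratic_kernel_le (c := a) (k0 := 0) (k1 := 0) (k2 := 1 / 2)
    (M := 0) hp0 hp1 (by linarith : 0 < a) (by linarith : a ≤ a + 2)
    (fun t h1 h2 => by
      have : 0 ≤ t ^ (p - 2) := Real.rpow_nonneg (by linarith) _
      rw [sub_zero]
      exact mul_nonneg (by nlinarith) this)
  have hB := rpow_quadratic_kernel_le (c := a + 2) (k0 := 0) (k1 := -1) (k2 := 0)
    (M := 0) hp0 hp1 (by linarith : 0 < a) (by linarith : a ≤ a + 2)
    (fun t h1 h2 => by
      have : 0 ≤ t ^ (p - 2) := Real.rpow_nonneg (by linarith) _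
      rw [sub_zero]
      exact mul_nonneg (by nlinarith) this)
  have hM := rpow_sub_one_le hp0 hp1 (by linarith : 0 < a + 2) (by linarith : (a + 2) / 2 ≤ a)
  have hq : 0 ≤ (p + 1) * p := by positivity
  have hfin : 0 ≤ (p + 1) * p * (2 * (a + 2) ^ (p - 1) - a ^ (p - 1)) :=
    mul_nonneg hq (by linarith)
  linear_combination hA + hB / 2 + hfin

/-- Comparison for the initial node of an odd row. -/
lemma rpow_odd_row_zero {p a : ℝ} (hp0 : 0 < p) (hp1 : p < 1) (ha : 0 < a) :
    ((p + 1) / 2) * (a ^ p - 3 * (a + 1) ^ p) - a * a ^ p + (a + 1) * (a + 1) ^ p ≤ 0 := by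
  have hB := rpow_quadratic_kernel_le (c := a) (k0 := 0) (k1 := 0) (k2 := 1 / 2)
    (M := 0) hp0 hp1 ha (by linarith : a ≤ a + 1)
    (fun t h1 h2 => by
      have : 0 ≤ t ^ (p - 2) := Real.rpow_nonneg (by linarith) _
      rw [sub_zero]
      exact mul_nonneg (by nlinarith) this)
  have hXY : a ^ p ≤ (a + 1) ^ p := Real.rpow_le_rpow ha.le (by linarith) hp0.le
  have hf : 0 ≤ (a + 1) ^ (p - 1) := Real.rpow_nonneg (by linarith) _
  have h1 : 0 ≤ (p + 1) * p * (a + 1) ^ (p - 1) := by positivity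
  have h2 : 0 ≤ (p + 1) * ((a + 1) ^ p - a ^ p) := mul_nonneg (by linarith) (by linarith)
  linear_combination hB + h1 / 2 + h2 / 2

lemma rpow_two_sub {ν t : ℝ} (hν : ν < 1) (ht : 0 ≤ t) : t ^ (2 - ν) = t * t ^ (1 - ν) := by
  rw [show 2 - ν = 1 + (1 - ν) by ring, Real.rpow_add' ht (by linarith), Real.rpow_one]

lemma alpha0_pos {ν : ℝ} (hν : ν ∈ Set.Ioo (0:ℝ) 1) : 0 < alpha0 ν := by
  have hΓ : 0 < Real.Gamma (3 - ν) := Real.Gamma_pos_of_pos (by linarith [hν.2])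
  have := hν.1
  unfold alpha0
  positivity

lemma alpha0_eq {ν : ℝ} :
    alpha0 ν = (1 / Real.Gamma (3 - ν)) * ((ν + 2) * (2 : ℝ) ^ (1 - ν) / 2) := by
  rw [alpha0, Real.rpow_sub (by norm_num), Real.rpow_one]
  field_simp

lemma one_div_Gamma_pos {ν : ℝ} (hν : ν < 1) : 0 < 1 / Real.Gamma (3 - ν) :=
  one_div_pos.2 (Real.Gamma_pos_of_pos (by linarith))

lemma Dbar_even (ν : ℝ) {m i : ℕ} (hi : 1 ≤ i) : Dbar ν m (2 * i) =
    (1 / Real.Gamma (3 - ν)) *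
      (-((2 - ν) / 2) * (((2 * m : ℝ) - 2 * i) ^ (1 - ν) + 6 * ((2 * m : ℝ) - 2 * i + 2) ^ (1 - ν)
          + ((2 * m : ℝ) - 2 * i + 4) ^ (1 - ν))
        - ((2 * m : ℝ) - 2 * i) ^ (2 - ν) + ((2 * m : ℝ) - 2 * i + 4) ^ (2 - ν)) := by
  have h2 : 2 * i / 2 = i := by omega
  rw [Dbar, if_neg (by omega), if_pos (by omega), h2]

lemma Dbar_odd (ν : ℝ) (m i : ℕ) : Dbar ν m (2 * i + 1) =
    (2 / Real.Gamma (3 - ν)) *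
      ((2 - ν) * (((2 * m : ℝ) - 2 * i) ^ (1 - ν) + ((2 * m : ℝ) - 2 * i + 2) ^ (1 - ν))
        + ((2 * m : ℝ) - 2 * i) ^ (2 - ν) - ((2 * m : ℝ) - 2 * i + 2) ^ (2 - ν)) := by
  have h2 : (2 * i + 1) / 2 = i := by omega
  rw [Dbar, if_neg (by omega), if_neg (by omega), h2]

lemma Dbar_odd_nonpos {ν : ℝ} (hν : ν ∈ Set.Ioo (0:ℝ) 1) {m i : ℕ} (hi : i ≤ m) :
    Dbar ν m (2 * i + 1) ≤ 0 := by
  have him : (i : ℝ) ≤ m := by exact_mod_cast hi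
  obtain ⟨h0, h1⟩ := hν
  have hΓ := one_div_Gamma_pos h1
  rw [Dbar_odd, rpow_two_sub h1 (by linarith), rpow_two_sub h1 (by linarith)]
  have h := rpow_trapezoid (p := 1 - ν) (by linarith) (by linarith)
    (by linarith : (0 : ℝ) ≤ 2 * m - 2 * i)
  have h2 := mul_nonpos_of_nonneg_of_nonpos hΓ.le h
  linear_combination 2 * h2

lemma Dbar_even_nonpos {ν : ℝ} (hν : ν ∈ Set.Ioo (0:ℝ) 1) {m i : ℕ} (hi : 1 ≤ i) (him : i < m) :
    Dbar ν m (2 * i) ≤ 0 := by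
  have him : (i : ℝ) + 1 ≤ m := by exact_mod_cast him
  obtain ⟨h0, h1⟩ := hν
  have hΓ := one_div_Gamma_pos h1
  rw [Dbar_even ν hi, rpow_two_sub h1 (by linarith), rpow_two_sub h1 (by linarith)]
  have h := rpow_even_node (p := 1 - ν) (c := 2 * m - 2 * i + 2) (by linarith) (by linarith)
    (by linarith)
  rw [show (2 * m - 2 * i + 2 - 2 : ℝ) = 2 * m - 2 * i by ring,
    show (2 * m - 2 * i + 2 + 2 : ℝ) = 2 * m - 2 * i + 4 by ring] at h
  have h2 := mul_nonpos_of_nonneg_of_nonpos hΓ.le h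
  linear_combination h2

lemma Dbar_zero_nonpos {ν : ℝ} (hν : ν ∈ Set.Ioo (0:ℝ) 1) {m : ℕ} (hm : 1 ≤ m) :
    Dbar ν m 0 ≤ 0 := by
  have hm : (1 : ℝ) ≤ m := by exact_mod_cast hm
  obtain ⟨h0, h1⟩ := hν
  have hΓ := one_div_Gamma_pos h1
  rw [Dbar, if_pos rfl, rpow_two_sub h1 (by linarith), rpow_two_sub h1 (by linarith)]
  have h := rpow_even_row_zero (p := 1 - ν) (a := 2 * m) (by linarith) (by linarith)
    (by linarith)
  have h2 := mul_nonpos_of_nonneg_of_nonpos hΓ.le h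
  linear_combination h2

lemma Dbar_nonpos {ν : ℝ} (hν : ν ∈ Set.Ioo (0:ℝ) 1) {m k : ℕ} (hk : k < 2 * m) :
    Dbar ν m k ≤ 0 := by
  obtain ⟨i, rfl | rfl⟩ := Nat.even_or_odd' k
  · rcases Nat.eq_zero_or_pos i with rfl | hi
    · exact Dbar_zero_nonpos hν (by omega)
    · exact Dbar_even_nonpos hν hi (by omega)
  · exact Dbar_odd_nonpos hν (by omega)

lemma theta_eq {ν : ℝ} (hν : 0 < ν) : theta ν * (2 + ν) = 2 * ν := by
  rw [theta]; field_simp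

lemma Dbar_last {ν : ℝ} (hν : ν ∈ Set.Ioo (0:ℝ) 1) (m : ℕ) :
    Dbar ν m (2 * m + 1) = -(2 * theta ν * alpha0 ν) := by
  obtain ⟨h0, h1⟩ := hν
  rw [Dbar_odd, sub_self, zero_add, Real.zero_rpow (by linarith), Real.zero_rpow (by linarith),
    rpow_two_sub h1 (by norm_num), alpha0_eq]
  linear_combination (1 / Real.Gamma (3 - ν)) * (2 : ℝ) ^ (1 - ν) * theta_eq h0

lemma two_rpow_lower {ν : ℝ} (hν : ν ∈ Set.Ioo (0:ℝ) 1) :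
    12 + 8 * ν + ν ^ 2 ≤ (2 : ℝ) ^ ν * (12 - ν ^ 2) := by
  obtain ⟨h0, h1⟩ := hν
  have hl := Real.log_two_gt_d9
  have hx : 0.693 * ν ≤ Real.log 2 * ν := by nlinarith
  have hq := Real.quadratic_le_exp_of_nonneg (by positivity : 0 ≤ Real.log 2 * ν)
  rw [← Real.rpow_def_of_pos (by norm_num)] at hq
  have hq2 : 1 + 0.693 * ν + (0.693 * ν) ^ 2 / 2 ≤ (2 : ℝ) ^ ν := by
    have : (0.693 * ν) ^ 2 ≤ (Real.log 2 * ν) ^ 2 := by gcongr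
    linarith
  have h3 := mul_le_mul_of_nonneg_right hq2 (by nlinarith : 0 ≤ 12 - ν ^ 2)
  have h2 : 0 ≤ ν * (1 - ν) := mul_nonneg h0.le (by linarith)
  nlinarith [mul_nonneg h2 h0.le, mul_nonneg (mul_nonneg h2 h0.le) h0.le]

lemma Dbar_penultimate_le {ν : ℝ} (hν : ν ∈ Set.Ioo (0:ℝ) 1) {m : ℕ} (hm : 1 ≤ m) :
    Dbar ν m (2 * m) ≤ theta ν ^ 2 * alpha0 ν := by
  have hB := two_rpow_lower hν
  obtain ⟨h0, h1⟩ := hν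
  have hΓ := one_div_Gamma_pos h1
  rw [Dbar_even ν hm, sub_self, zero_add, zero_add, Real.zero_rpow (by linarith),
    Real.zero_rpow (by linarith), rpow_two_sub h1 (by norm_num), alpha0, theta,
    show (4 : ℝ) = 2 * 2 by norm_num, Real.mul_rpow (by norm_num) (by norm_num),
    Real.rpow_sub (by norm_num), Real.rpow_one]
  have hpos : 0 < (2 : ℝ) ^ ν := by positivity
  generalize (2 : ℝ) ^ ν = B at *
  have hG : 0 < Real.Gamma (3 - ν) := one_div_pos.1 hΓ
  generalize Real.Gamma (3 - ν) = g at *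
  rw [← sub_nonneg]
  have : (2 * ν / (2 + ν)) ^ 2 * ((ν + 2) / (B * g)) -
      1 / g * (-((2 - ν) / 2) * (0 + 6 * (2 / B) + 2 / B * (2 / B)) - 0
        + 2 * 2 * (2 / B * (2 / B))) =
      2 / (g * B ^ 2 * (2 + ν)) * (B * (12 - ν ^ 2) - (12 + 8 * ν + ν ^ 2)) := by
    field_simp
    ring
  rw [this]
  exact mul_nonneg (by positivity) (by linarith)

lemma Dbar_shift (ν : ℝ) (m : ℕ) {k : ℕ} (hk : 1 ≤ k) : Dbar ν (m + 1) (k + 2) = Dbar ν m k := by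
  obtain ⟨i, rfl | rfl⟩ := Nat.even_or_odd' k
  · rw [show 2 * i + 2 = 2 * (i + 1) by ring, Dbar_even ν (by omega), Dbar_even ν (by omega)]
    push_cast
    rw [show (2 * (m + 1) - 2 * (i + 1) : ℝ) = 2 * m - 2 * i by ring]
  · rw [show 2 * i + 1 + 2 = 2 * (i + 1) + 1 by ring, Dbar_odd, Dbar_odd]
    push_cast
    rw [show (2 * (m + 1) - 2 * (i + 1) : ℝ) = 2 * m - 2 * i by ring]

lemma Dbar_zero_succ (ν : ℝ) (m : ℕ) :
    Dbar ν (m + 1) 0 + Dbar ν (m + 1) 1 + Dbar ν (m + 1) 2 = Dbar ν m 0 := by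
  have h1 := Dbar_odd ν (m + 1) 0
  have h2 := Dbar_even ν (m := m + 1) (i := 1) le_rfl
  norm_num only at h1 h2
  rw [h1, h2, Dbar, Dbar, if_pos rfl, if_pos rfl]
  push_cast
  rw [show (2 * (m + 1) : ℝ) = 2 * m + 2 by ring, sub_zero,
    show (2 * m + 2 - 2 : ℝ) = 2 * m by ring, show (2 * m + 2 + 2 : ℝ) = 2 * m + 4 by ring]
  ring

lemma sum_Dbar {ν : ℝ} (hν : ν < 1) (m : ℕ) :
    ∑ k ∈ Finset.range (2 * m + 2), Dbar ν m k = -alpha0 ν := by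
  induction m with
  | zero =>
    have h1 := Dbar_odd ν 0 0
    norm_num only at h1
    rw [Finset.sum_range_succ, Finset.sum_range_one, h1, Dbar, if_pos rfl, alpha0_eq]
    have : 1 - ν ≠ 0 := by linarith
    have : 2 - ν ≠ 0 := by linarith
    simp only [Nat.cast_zero, mul_zero, sub_zero, zero_add, Real.zero_rpow, ne_eq, *,
      not_false_eq_true, rpow_two_sub hν (by norm_num : (0 : ℝ) ≤ 2)]
    ring
  | succ m ih =>
    rw [show 2 * (m + 1) + 2 = 2 * m + 1 + 1 + 1 + 1 by ring, Finset.sum_range_succ',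
      Finset.sum_range_succ', Finset.sum_range_succ']
    rw [show 2 * m + 2 = 2 * m + 1 + 1 by ring, Finset.sum_range_succ'] at ih
    rw [Finset.sum_congr rfl fun k _ => Dbar_shift ν m (by omega : 1 ≤ k + 1)]
    linear_combination ih + Dbar_zero_succ ν m

lemma Dco_of_three_le (ν : ℝ) (m : ℕ) {k : ℕ} (hk : 3 ≤ k) : Dco ν m k = Dbar ν m (k + 1) := by
  rw [Dco, if_neg (by omega), if_neg (by omega), if_neg (by omega)]

lemma Dco_initial (ν : ℝ) (m : ℕ) : Dco ν m 0 + Dco ν m 1 + Dco ν m 2 =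
    Dbar ν m 0 + Dbar ν m 1 + Dbar ν m 2 + Dbar ν m 3 := by
  have h1 := Dbar_odd ν m 0
  have h2 := Dbar_even ν (m := m) (i := 1) le_rfl
  have h3 := Dbar_odd ν m 1
  norm_num only at h1 h2 h3
  rw [h1, h2, h3, Dbar, if_pos rfl]
  simp only [Dco, if_true, one_ne_zero, two_ne_zero, if_false, OfNat.ofNat_ne_one]
  rw [sub_zero,
    show (2 * m - 2 + 2 : ℝ) = 2 * m by ring, show (2 * m - 2 + 4 : ℝ) = 2 * m + 2 by ring]
  ring

lemma sum_Dco {ν : ℝ} (hν : ν < 1) {m : ℕ} (hm : 1 ≤ m) :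
    ∑ k ∈ Finset.range (2 * m + 1), Dco ν m k = -alpha0 ν := by
  obtain ⟨n, rfl⟩ := Nat.exists_eq_add_of_le' hm
  have h := sum_Dbar hν (n + 1)
  rw [show 2 * (n + 1) + 2 = 2 * n + 1 + 1 + 1 + 1 by ring, Finset.sum_range_succ',
    Finset.sum_range_succ', Finset.sum_range_succ', Finset.sum_range_succ'] at h
  rw [show 2 * (n + 1) + 1 = 2 * n + 1 + 1 + 1 by ring, Finset.sum_range_succ',
    Finset.sum_range_succ', Finset.sum_range_succ',
    Finset.sum_congr rfl fun k _ => Dco_of_three_le ν (n + 1) (by omega : 3 ≤ k + 1 + 1 + 1)]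
  rw [← h]
  linear_combination Dco_initial ν (n + 1)

lemma Dco_zero_nonpos {ν : ℝ} (hν : ν ∈ Set.Ioo (0:ℝ) 1) {m : ℕ} (hm : 1 ≤ m) :
    Dco ν m 0 ≤ 0 := by
  have hm : (1 : ℝ) ≤ m := by exact_mod_cast hm
  obtain ⟨h0, h1⟩ := hν
  have hΓ := one_div_Gamma_pos h1
  rw [Dco, if_pos rfl, rpow_two_sub h1 (by linarith), rpow_two_sub h1 (by linarith)]
  have h := rpow_odd_row_zero (p := 1 - ν) (a := 2 * m) (by linarith) (by linarith)
    (by linarith)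
  have h2 := mul_nonpos_of_nonneg_of_nonpos hΓ.le h
  linear_combination h2

lemma Dco_one_nonpos {ν : ℝ} (hν : ν ∈ Set.Ioo (0:ℝ) 1) {m : ℕ} (hm : 2 ≤ m) :
    Dco ν m 1 ≤ 0 := by
  have hm : (2 : ℝ) ≤ m := by exact_mod_cast hm
  obtain ⟨h0, h1⟩ := hν
  have hΓ := one_div_Gamma_pos h1
  rw [Dco, if_neg one_ne_zero, if_pos rfl, rpow_two_sub h1 (by linarith),
    rpow_two_sub h1 (by linarith), rpow_two_sub h1 (by linarith)]
  have h := rpow_odd_row_one (p := 1 - ν) (a := 2 * m) (by linarith) (by linarith)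
    (by linarith)
  have h2 := mul_nonpos_of_nonneg_of_nonpos hΓ.le h
  linear_combination h2

lemma Dco_two_nonpos {ν : ℝ} (hν : ν ∈ Set.Ioo (0:ℝ) 1) {m : ℕ} (hm : 2 ≤ m) :
    Dco ν m 2 ≤ 0 := by
  have hm : (2 : ℝ) ≤ m := by exact_mod_cast hm
  obtain ⟨h0, h1⟩ := hν
  have hΓ := one_div_Gamma_pos h1
  rw [Dco, if_neg two_ne_zero, if_neg (by norm_num), if_pos rfl, rpow_two_sub h1 (by linarith),
    rpow_two_sub h1 (by linarith), rpow_two_sub h1 (by linarith)]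
  have h := rpow_odd_row_two (p := 1 - ν) (a := 2 * m) (by linarith) (by linarith)
    (by linarith)
  have h2 := mul_nonpos_of_nonneg_of_nonpos hΓ.le h
  linear_combination h2

lemma Dco_nonpos {ν : ℝ} (hν : ν ∈ Set.Ioo (0:ℝ) 1) {m k : ℕ} (hm : 2 ≤ m) (hk : k < 2 * m - 1) :
    Dco ν m k ≤ 0 := by
  match k with
  | 0 => exact Dco_zero_nonpos hν (by omega)
  | 1 => exact Dco_one_nonpos hν hm
  | 2 => exact Dco_two_nonpos hν hm
  | k + 3 =>
    rw [Dco_of_three_le ν m (by omega)]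
    exact Dbar_nonpos hν (by omega)

/-- Summation by parts turning a history sum in `y` into one in `z k = y k - θ * y (k - 1)`. -/
lemma sum_mul_eq_sum_transformed {θ : ℝ} {c e y z : ℕ → ℝ} {j : ℕ}
    (he : ∀ k < j, e k = c k + θ * e (k + 1)) (hz0 : z 0 = y 0)
    (hz : ∀ k, z (k + 1) = y (k + 1) - θ * y k) :
    ∀ n < j, ∑ k ∈ Finset.range (n + 1), c k * y k + θ * e (n + 1) * y n
      = ∑ k ∈ Finset.range (n + 1), e k * z k := by
  intro n
  induction n with
  | zero =>
    intro hn
    rw [Finset.sum_range_one, Finset.sum_range_one, hz0, he 0 hn]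
    ring
  | succ n ih =>
    intro hn
    rw [Finset.sum_range_succ, Finset.sum_range_succ _ (n + 1), ← ih (by omega), hz,
      he (n + 1) hn]
    ring

/-- Coefficients of the transformed history sum, listed backwards from the current step. -/
def transformedCoeff (θ : ℝ) (c : ℕ → ℝ) (n : ℕ) : ℕ → ℝ
  | 0 => -1
  | i + 1 => c (n + 1 - i) + θ * transformedCoeff θ c n i

/-- One step of the discrete energy estimate. -/
lemma energy_step {θ A W : ℝ} (hθ0 : 0 ≤ θ) (hθ1 : θ < 1) (hA : 0 ≤ A) {c y : ℕ → ℝ} {n : ℕ}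
    (hsum : ∑ k ∈ Finset.range (n + 2), c k = 1)
    (hlast : θ + θ ^ 2 ≤ c (n + 1))
    (hpen : 0 ≤ c n + θ * (c (n + 1) - θ))
    (hc : ∀ k < n, 0 ≤ c k)
    (heq : (1 + A) * y (n + 2) = ∑ k ∈ Finset.range (n + 2), c k * y k)
    (hW0 : y 0 ^ 2 ≤ W)
    (hW : ∀ k ≤ n, (y (k + 1) - θ * y k) ^ 2 + A * y (k + 1) ^ 2 ≤ W) :
    (y (n + 2) - θ * y (n + 1)) ^ 2 + A * y (n + 2) ^ 2 ≤ W := by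
  set e : ℕ → ℝ := fun k => transformedCoeff θ c n (n + 2 - k) with he_def
  have he : ∀ k < n + 2, e k = c k + θ * e (k + 1) := by
    intro k hk
    have h1 : n + 2 - k = (n + 1 - k) + 1 := by omega
    have h2 : n + 2 - (k + 1) = n + 1 - k := by omega
    have h3 : n + 1 - (n + 1 - k) = k := by omega
    simp only [he_def, h1, h2, transformedCoeff, h3]
  have he_end : e (n + 2) = -1 := by simp [he_def, transformedCoeff]
  have he_last : e (n + 1) = c (n + 1) - θ := by
    rw [he (n + 1) (by omega), he_end]; ring
  have he_last' : θ ^ 2 ≤ e (n + 1) := by linarith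
  have htail : ∀ i ≤ n, 0 ≤ e (n - i) := by
    intro i
    induction i with
    | zero =>
      intro _
      rw [Nat.sub_zero, he n (by omega), he_last]
      exact hpen
    | succ i ih =>
      intro hi
      rw [he _ (by omega), show n - (i + 1) + 1 = n - i by omega]
      exact add_nonneg (hc _ (by omega)) (mul_nonneg hθ0 (ih (by omega)))
  have hpos : ∀ k < n + 2, 0 ≤ e k := by
    intro k hk
    rcases Nat.lt_or_ge n k with h | h
    · rw [show k = n + 1 by omega]; exact (sq_nonneg θ).trans he_last'
    · have := htail (n - k) (by omega)
      rwa [show n - (n - k) = k by omega] at this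
  set z : ℕ → ℝ := fun k => Nat.casesOn k (y 0) fun k => y (k + 1) - θ * y k with hz
  have hmain := sum_mul_eq_sum_transformed (y := y) (z := z) he rfl (fun _ => rfl)
    (n + 1) (by omega)
  have hone := sum_mul_eq_sum_transformed (y := fun _ => 1)
    (z := fun k => Nat.casesOn k 1 fun _ => 1 - θ) he rfl (fun _ => by simp) (n + 1) (by omega)
  simp only [mul_one, hsum, he_end] at hone
  rw [← heq, he_end] at hmain
  have hS : ∑ k ∈ Finset.range (n + 2), e k ≤ 1 := by
    rw [Finset.sum_range_succ'] at hone ⊢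
    simp only [← Finset.sum_mul] at hone
    replace hone : 1 + θ * -1 =
      (∑ k ∈ Finset.range (n + 1), e (k + 1)) * (1 - θ) + e 0 * 1 := hone
    have h0 := mul_nonneg hθ0 (hpos 0 (by omega))
    refine le_of_mul_le_mul_right ?_ (sub_pos.2 hθ1)
    linarith
  have hzW : ∀ k < n + 2, z k ^ 2 ≤ W := by
    intro k hk
    cases k with
    | zero => exact hW0
    | succ k =>
      have := hW k (by omega)
      have h2 : 0 ≤ A * y (k + 1) ^ 2 := by positivity
      show (y (k + 1) - θ * y k) ^ 2 ≤ W
      linarith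
  set x := y (n + 2) - θ * y (n + 1) with hx
  have hcross : ∑ k ∈ Finset.range (n + 2), e k * z k * x ≤
      (∑ k ∈ Finset.range (n + 2), e k) * ((W + x ^ 2) / 2)
        - e (n + 1) * (A * y (n + 1) ^ 2 / 2) := by
    rw [Finset.sum_range_succ, Finset.sum_range_succ _ (n + 1), add_mul, Finset.sum_mul]
    have h1 : ∑ k ∈ Finset.range (n + 1), e k * z k * x ≤
        ∑ k ∈ Finset.range (n + 1), e k * ((W + x ^ 2) / 2) := by
      refine Finset.sum_le_sum fun k hk => ?_
      have hk' := Finset.mem_range.1 hk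
      rw [mul_assoc]
      refine mul_le_mul_of_nonneg_left ?_ (hpos k (by omega))
      nlinarith [hzW k (by omega), sq_nonneg (z k - x)]
    have h2 : e (n + 1) * (z (n + 1) * x) ≤
        e (n + 1) * ((W + x ^ 2) / 2 - A * y (n + 1) ^ 2 / 2) := by
      refine mul_le_mul_of_nonneg_left ?_ (hpos _ (by omega))
      have h3 : z (n + 1) ^ 2 + A * y (n + 1) ^ 2 ≤ W := hW n le_rfl
      nlinarith [sq_nonneg (z (n + 1) - x)]
    linarith
  rw [← Finset.sum_mul, ← hmain] at hcross
  have hW' : 0 ≤ W := (sq_nonneg _).trans hW0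
  have h4 := mul_le_mul_of_nonneg_right hS (by positivity : 0 ≤ (W + x ^ 2) / 2)
  have h5 := mul_le_mul_of_nonneg_right he_last' (by positivity : 0 ≤ A * y (n + 1) ^ 2 / 2)
  have hx' : 2 * (((1 + A) * y (n + 2) + θ * -1 * y (n + 1)) * x) =
      2 * x ^ 2 + A * (y (n + 2) ^ 2 + x ^ 2 - θ ^ 2 * y (n + 1) ^ 2) := by
    rw [hx]; ring
  nlinarith [mul_nonneg hA (sq_nonneg x)]

/-- The scheme coefficients at step `3`. -/
lemma step_three_coeff {ν : ℝ} (hν : ν ∈ Set.Ioo (0:ℝ) 1) :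
    dco ν 3 1 = -3 + 3 * (2 / 3 : ℝ) ^ ν * (2 + 2 * ν) / (ν + 2) ∧
    dco ν 3 2 = 3 - (4 + ν) * (3 * (2 / 3 : ℝ) ^ ν) / (2 * (ν + 2)) := by
  obtain ⟨h0, h1⟩ := hν
  have hG : 0 < Real.Gamma (3 - ν) := one_div_pos.1 (one_div_Gamma_pos h1)
  have e1 : dco ν 3 1 = -Dco ν 1 1 / alpha0 ν := rfl
  have e2 : dco ν 3 2 = -Dco ν 1 2 / alpha0 ν := rfl
  rw [e1, e2, Dco, Dco, if_neg one_ne_zero, if_pos rfl, if_neg two_ne_zero, if_neg (by norm_num),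
    if_pos rfl, alpha0, Nat.cast_one, mul_one, sub_self, Real.zero_rpow (by linarith),
    Real.zero_rpow (by linarith), show (2 + 1 : ℝ) = 3 by norm_num,
    rpow_two_sub h1 (by norm_num), rpow_two_sub h1 (by norm_num),
    Real.rpow_sub (by norm_num), Real.rpow_sub (by norm_num), Real.rpow_one, Real.rpow_one,
    Real.div_rpow (by norm_num) (by norm_num)]
  have : 0 < (2 : ℝ) ^ ν := by positivity
  have : 0 < (3 : ℝ) ^ ν := by positivity
  generalize (2 : ℝ) ^ ν = B at *
  generalize (3 : ℝ) ^ ν = T at *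
  generalize Real.Gamma (3 - ν) = g at *
  constructor <;> field_simp <;> ring

lemma two_thirds_rpow_bounds {ν : ℝ} (hν : ν ∈ Set.Ioo (0:ℝ) 1) :
    (2 / 3 : ℝ) ^ ν ≤ 1 - ν / 3 ∧ 2 ≤ (2 / 3 : ℝ) ^ ν * (2 + ν) := by
  obtain ⟨h0, h1⟩ := hν
  constructor
  · have := rpow_one_add_le_one_add_mul_self (s := -1 / 3) (by norm_num) h0.le h1.le
    norm_num at this
    linarith
  · have h := rpow_one_add_le_one_add_mul_self (s := 1 / 2) (by norm_num) h0.le h1.le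
    have hm : (2 / 3 : ℝ) ^ ν * (1 + 1 / 2) ^ ν = 1 := by
      rw [← Real.mul_rpow (by norm_num) (by norm_num)]; norm_num
    have := mul_le_mul_of_nonneg_left h (by positivity : 0 ≤ (2 / 3 : ℝ) ^ ν)
    linarith

lemma step_three_last {ν : ℝ} (hν : ν ∈ Set.Ioo (0:ℝ) 1) :
    theta ν + theta ν ^ 2 ≤ dco ν 3 2 := by
  rw [(step_three_coeff hν).2, theta]
  have hR := (two_thirds_rpow_bounds hν).1
  obtain ⟨h0, h1⟩ := hν
  generalize (2 / 3 : ℝ) ^ ν = R at *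
  rw [← sub_nonneg]
  have : 3 - (4 + ν) * (3 * R) / (2 * (ν + 2)) - (2 * ν / (2 + ν) + (2 * ν / (2 + ν)) ^ 2) =
      (3 / 2 * (4 + ν) * (ν + 2) * (1 - ν / 3 - R) + ν * (3 - 3 / 2 * ν + ν ^ 2 / 2))
        / (ν + 2) ^ 2 := by
    field_simp
    ring
  rw [this]
  have := sub_nonneg.2 hR
  have : 0 ≤ 3 - 3 / 2 * ν + ν ^ 2 / 2 := by nlinarith
  positivity

lemma step_three_penultimate {ν : ℝ} (hν : ν ∈ Set.Ioo (0:ℝ) 1) :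
    0 ≤ dco ν 3 1 + theta ν * (dco ν 3 2 - theta ν) := by
  rw [(step_three_coeff hν).2, (step_three_coeff hν).1, theta]
  have hR := (two_thirds_rpow_bounds hν).2
  obtain ⟨h0, h1⟩ := hν
  generalize (2 / 3 : ℝ) ^ ν = R at *
  have : -3 + 3 * R * (2 + 2 * ν) / (ν + 2) + 2 * ν / (2 + ν) *
      (3 - (4 + ν) * (3 * R) / (2 * (ν + 2)) - 2 * ν / (2 + ν)) =
      (3 * (4 + 2 * ν + ν ^ 2) * (R * (2 + ν) - 2) + ν ^ 2 * (4 - ν)) / (ν + 2) ^ 3 := by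
    field_simp
    ring
  rw [this]
  have := sub_nonneg.2 hR
  have : 0 ≤ 4 - ν := by linarith
  positivity

lemma dco_odd (ν : ℝ) (m k : ℕ) : dco ν (2 * m + 1) k = -Dco ν m k / alpha0 ν := by
  rw [dco, if_pos (by omega), show (2 * m + 1) / 2 = m by omega]

lemma dco_even (ν : ℝ) (m k : ℕ) : dco ν (2 * m + 2) k = -Dbar ν m k / alpha0 ν := by
  rw [dco, if_neg (by omega), show (2 * m + 2) / 2 - 1 = m by omega]

lemma theta_nonneg {ν : ℝ} (hν : 0 < ν) : 0 ≤ theta ν := by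
  unfold theta; positivity

lemma theta_lt_one {ν : ℝ} (hν : ν ∈ Set.Ioo (0:ℝ) 1) : theta ν < 1 := by
  have h0 := hν.1
  rw [theta, div_lt_one (by linarith)]
  linarith [hν.2]

lemma sum_dco {ν : ℝ} (hν : ν ∈ Set.Ioo (0:ℝ) 1) {j : ℕ} (hj : 3 ≤ j) :
    ∑ k ∈ Finset.range j, dco ν j k = 1 := by
  have hα := (alpha0_pos hν).ne'
  obtain ⟨m, rfl | rfl⟩ := Nat.even_or_odd' j
  · obtain ⟨m, rfl⟩ := Nat.exists_eq_add_of_le' (show 1 ≤ m by omega)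
    simp only [show 2 * (m + 1) = 2 * m + 2 by ring, dco_even, neg_div, Finset.sum_neg_distrib,
      ← Finset.sum_div, sum_Dbar hν.2]
    field_simp
  · simp only [dco_odd, neg_div, Finset.sum_neg_distrib, ← Finset.sum_div,
      sum_Dco hν.2 (show 1 ≤ m by omega)]
    field_simp

lemma dco_nonneg {ν : ℝ} (hν : ν ∈ Set.Ioo (0:ℝ) 1) {n k : ℕ} (hn : 1 ≤ n) (hk : k < n) :
    0 ≤ dco ν (n + 2) k := by
  have hα := (alpha0_pos hν).le
  obtain ⟨m, rfl | rfl⟩ := Nat.even_or_odd' n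
  · rw [dco_even]
    exact div_nonneg (neg_nonneg.2 (Dbar_nonpos hν hk)) hα
  · rw [show 2 * m + 1 + 2 = 2 * (m + 1) + 1 by ring, dco_odd]
    refine div_nonneg (neg_nonneg.2 ?_) hα
    rcases Nat.eq_zero_or_pos m with rfl | hm
    · rw [show k = 0 by omega]
      exact Dco_zero_nonpos hν le_rfl
    · exact Dco_nonpos hν (by omega) (by omega)

lemma dco_last {ν : ℝ} (hν : ν ∈ Set.Ioo (0:ℝ) 1) {n : ℕ} (hn : 2 ≤ n) :
    dco ν (n + 2) (n + 1) = 2 * theta ν := by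
  have hα := (alpha0_pos hν).ne'
  obtain ⟨m, rfl | rfl⟩ := Nat.even_or_odd' n
  · rw [dco_even, Dbar_last hν]
    field_simp
  · rw [show 2 * m + 1 + 2 = 2 * (m + 1) + 1 by ring, dco_odd, Dco_of_three_le _ _ (by omega),
      show 2 * m + 1 + 1 + 1 = 2 * (m + 1) + 1 by ring, Dbar_last hν]
    field_simp

lemma dco_penultimate {ν : ℝ} (hν : ν ∈ Set.Ioo (0:ℝ) 1) {n : ℕ} (hn : 2 ≤ n) :
    0 ≤ dco ν (n + 2) n + theta ν ^ 2 := by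
  have hα := alpha0_pos hν
  obtain ⟨m, hm, hd⟩ : ∃ m, 1 ≤ m ∧ dco ν (n + 2) n = -Dbar ν m (2 * m) / alpha0 ν := by
    obtain ⟨m, rfl | rfl⟩ := Nat.even_or_odd' n
    · exact ⟨m, by omega, dco_even ν m _⟩
    · refine ⟨m + 1, by omega, ?_⟩
      rw [show 2 * m + 1 + 2 = 2 * (m + 1) + 1 by ring, dco_odd, Dco_of_three_le _ _ (by omega),
        show 2 * m + 1 + 1 = 2 * (m + 1) by ring]
  have h := Dbar_penultimate_le hν hm
  rw [hd, neg_div, neg_add_eq_sub, sub_nonneg, div_le_iff₀ hα]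
  exact h

lemma two_mul_theta_ge {ν : ℝ} (hν : ν ∈ Set.Ioo (0:ℝ) 1) :
    theta ν + theta ν ^ 2 ≤ 2 * theta ν := by
  nlinarith [theta_nonneg hν.1, theta_lt_one hν]

/-- The energy bound at the first step, from the coupled starting equations. -/
lemma first_step_energy {ν A B y0 y1 y2 : ℝ} (hν : ν ∈ Set.Ioo (0:ℝ) 1) (hA : 0 < A)
    (hB1 : 1 ≤ B) (hB2 : B ≤ 1 + ν)
    (h1 : B * ((3 * ν - 4) * y0 + 4 * (1 - ν) * y1 + ν * y2) = -(2 * (ν + 2) * A * y1))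
    (h2 : (1 + A) * y2 = 2 * theta ν * y1 + (1 - 2 * theta ν) * y0) :
    (y1 - theta ν * y0) ^ 2 + A * y1 ^ 2 ≤ y0 ^ 2 := by
  have hθ0 := theta_nonneg hν.1
  have hθ1 := theta_lt_one hν
  have hθ := theta_eq hν.1
  obtain ⟨h0, h01⟩ := hν
  generalize theta ν = θ at *
  set N := B * ((4 - 3 * ν) * (1 + A) - ν * (1 - 2 * θ)) with hN
  set D := (2 * (ν + 2) * A + 4 * B * (1 - ν)) * (1 + A) + 2 * θ * ν * B with hD
  set X := 2 * (ν + 2) * (1 + A) - B * ν with hX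
  have hDy : D * y1 = N * y0 := by
    rw [hD, hN]
    linear_combination (1 + A) * h1 - B * ν * h2
  have hν1 : 0 ≤ 1 - ν := by linarith
  have hDpos : 0 < D := by
    have : 0 < 2 * (ν + 2) * A * (1 + A) := by positivity
    have : 0 ≤ 4 * B * (1 - ν) * (1 + A) := by positivity
    have : 0 ≤ 2 * θ * ν * B := by positivity
    rw [hD]; linarith
  have hNnn : 0 ≤ N := by
    refine mul_nonneg (by linarith) ?_
    nlinarith [mul_nonneg hθ0 h0.le, mul_nonneg (by linarith : 0 ≤ 4 - 3 * ν) hA.le]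
  have hdiff : D - N = A * X := by rw [hD, hN, hX]; ring
  have hNX : N ≤ X := by
    have hb : (1 + A) * (B * (4 - 3 * ν) - 2 * (ν + 2)) + B * ν * (2 * θ) ≤ 0 := by
      have hc : B * (4 - 3 * ν) - 2 * (ν + 2) ≤ -ν - 3 * ν ^ 2 := by nlinarith
      have hθν : θ ≤ ν := by nlinarith
      have hd : B * ν * (2 * θ) ≤ (1 + ν) * ν * (2 * θ) := by gcongr
      have hf : (2 + ν) * ((1 + ν) * ν * (2 * θ)) = (1 + ν) * ν * (4 * ν) := by
        linear_combination 2 * (1 + ν) * ν * hθ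
      have hg : (1 + ν) * ν * (2 * θ) ≤ ν + 3 * ν ^ 2 := by nlinarith [mul_pos h0 h0]
      nlinarith [mul_pos hA h0, mul_pos h0 h0]
    have : N - X = (1 + A) * (B * (4 - 3 * ν) - 2 * (ν + 2)) + B * ν * (2 * θ) := by
      rw [hN, hX]; ring
    linarith
  have hX0 : 0 ≤ X := hNnn.trans hNX
  have hpoly : (N - θ * D) ^ 2 + A * N ^ 2 ≤ D ^ 2 := by
    have hα : A * X * N ≤ (A * X + θ * D) * ((1 - θ) * D + N) := by
      have : 0 ≤ (1 - θ) * D := mul_nonneg (by linarith) hDpos.le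
      have : 0 ≤ A * X * ((1 - θ) * D) := by positivity
      have : 0 ≤ θ * D * ((1 - θ) * D + N) := by positivity
      linarith
    have hβ : A * N ^ 2 ≤ A * X * N := by
      nlinarith [mul_le_mul_of_nonneg_right hNX (mul_nonneg hA.le hNnn)]
    rw [← hdiff] at hα hβ
    linear_combination hα + hβ
  have hscale : D ^ 2 * ((y1 - θ * y0) ^ 2 + A * y1 ^ 2) =
      ((N - θ * D) ^ 2 + A * N ^ 2) * y0 ^ 2 := by
    have e : D ^ 2 * ((y1 - θ * y0) ^ 2 + A * y1 ^ 2) =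
      (D * y1 - θ * D * y0) ^ 2 + A * (D * y1) ^ 2 := by ring
    rw [e, hDy]
    ring
  have := mul_le_mul_of_nonneg_right hpoly (sq_nonneg y0)
  rw [← hscale] at this
  exact le_of_mul_le_mul_left this (by positivity)

theorem stmt8 (ν lam Δx : ℝ) (hν : ν ∈ Set.Ioo (0:ℝ) 1) (hlam : 0 < lam) (hΔx : 0 < Δx)
    (y : ℕ → ℝ)
    (h1 : Δx ^ (-ν) * (Dhat0 ν * y 0 + Dhat1 ν * y 1 + Dhat2 ν * y 2) = -lam * y 1)
    (h2 : Δx ^ (-ν) * (Dtil0 ν * y 0 + Dtil1 ν * y 1 + Dtil2 ν * y 2) = -lam * y 2)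
    (h3 : ∀ j : ℕ, 3 ≤ j →
      (1 + lam * Δx ^ ν / alpha0 ν) * y j = ∑ k ∈ Finset.range j, dco ν j k * y k) :
    ∀ j : ℕ, 1 ≤ j →
      (y j - theta ν * y (j - 1)) ^ 2 + (lam * Δx ^ ν / alpha0 ν) * (y j) ^ 2 ≤ (y 0) ^ 2 := by
  have hα := alpha0_pos hν
  have hΓ : 0 < Real.Gamma (3 - ν) := one_div_pos.1 (one_div_Gamma_pos hν.2)
  have h2ν : 0 < (2 : ℝ) ^ ν := by positivity
  have hx : Δx ^ (-ν) * Δx ^ ν = 1 := by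
    rw [← Real.rpow_add hΔx, neg_add_cancel, Real.rpow_zero]
  have hx0 : Δx ^ (-ν) ≠ 0 := (Real.rpow_pos_of_pos hΔx _).ne'
  have hθ0 := theta_nonneg hν.1
  have hθ1 := theta_lt_one hν
  have hθ := theta_eq hν.1
  set A := lam * Δx ^ ν / alpha0 ν with hAdef
  have hA : 0 < A := by positivity
  have hAα : A * alpha0 ν = lam * Δx ^ ν := by rw [hAdef]; field_simp
  have clear_step : ∀ {S v : ℝ}, Δx ^ (-ν) * S = -lam * v → S = -(A * alpha0 ν * v) := by
    intro S v h
    refine mul_left_cancel₀ hx0 ?_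
    rw [hAα]
    linear_combination h + lam * v * hx
  have h0 := hν.1
  have hB1 : (1 : ℝ) ≤ (2 : ℝ) ^ ν := Real.one_le_rpow (by norm_num) h0.le
  have hB2 : (2 : ℝ) ^ ν ≤ 1 + ν := by
    have := rpow_one_add_le_one_add_mul_self (s := 1) (by norm_num) h0.le hν.2.le
    norm_num at this
    exact this
  have e1 : (2 : ℝ) ^ ν * ((3 * ν - 4) * y 0 + 4 * (1 - ν) * y 1 + ν * y 2)
      = -(2 * (ν + 2) * A * y 1) := by
    have h := clear_step h1
    simp only [Dhat0, Dhat1, Dhat2, alpha0] at h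
    field_simp at h
    linear_combination h
  have e2 : (1 + A) * y 2 = 2 * theta ν * y 1 + (1 - 2 * theta ν) * y 0 := by
    have h := clear_step h2
    simp only [Dtil0, Dtil1, Dtil2, alpha0] at h
    field_simp at h
    refine mul_left_cancel₀ (by positivity : ν + 2 ≠ 0) ?_
    linear_combination h - 2 * (y 1 - y 0) * hθ
  intro j
  induction j using Nat.strong_induction_on with
  | _ j ih =>
    intro hj
    match j with
    | 1 => exact first_step_energy hν hA hB1 hB2 e1 e2
    | n + 2 =>
      have hW : ∀ k ≤ n, (y (k + 1) - theta ν * y k) ^ 2 + A * y (k + 1) ^ 2 ≤ y 0 ^ 2 :=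
        fun k hk => ih (k + 1) (by omega) (by omega)
      match n with
      | 0 =>
        refine energy_step (c := fun k => if k = 0 then 1 - 2 * theta ν else 2 * theta ν)
          hθ0 hθ1 hA.le ?_ ?_ ?_ (by simp) ?_ le_rfl hW
        · simp [Finset.sum_range_succ]
        · simpa using two_mul_theta_ge hν
        · simp only [if_true, zero_add, one_ne_zero, if_false]
          nlinarith [sq_nonneg (1 - theta ν)]
        · simp only [Finset.sum_range_succ, Finset.sum_range_zero, if_true, zero_add, one_ne_zero,
            if_false]
          linear_combination e2
      | 1 =>
        exact energy_step hθ0 hθ1 hA.le (sum_dco hν le_rfl) (step_three_last hν)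
          (step_three_penultimate hν) (fun k hk => dco_nonneg hν le_rfl hk) (h3 3 le_rfl) le_rfl hW
      | n + 2 =>
        refine energy_step hθ0 hθ1 hA.le (sum_dco hν (by omega)) ?_ ?_
          (fun k hk => dco_nonneg hν (by omega) hk) (h3 _ (by omega)) le_rfl hW
        · rw [dco_last hν (by omega)]
          exact two_mul_theta_ge hν
        · rw [dco_last hν (by omega)]
          linear_combination dco_penultimate hν (n := n + 2) (by omega)
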